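/- A weak Hopf algebra A over a field K is a symmetric algebra (i.e. there exists a K-linear functional τ : A → K with τ(xy) = τ(yx) for all x, y and with the bilinear form (x, y) ↦ τ(xy) nondegenerate) if and only if A contains a nondegenerate two-sided integral and the square of the antipode is an inner automorphism (there exists an invertible g ∈ A with S(S(x)) = g x g⁻¹ for all x ∈ A). -/

import Mathlib

open TensorProduct

noncomputable section

variable (K : Type*) [Field K] (A : Type*) [Ring A] [Algebra K A]

/-- `Π^L(x) = Σ ε(1₍₁₎ x) 1₍₂₎`. -/
def piL (Δ : A →ₗ[K] A ⊗[K] A) (ε : A →ₗ[K] K) : A →ₗ[K] A :=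
  (TensorProduct.lid K A).toLinearMap ∘ₗ ε.rTensor A ∘ₗ
    LinearMap.mulLeft K (Δ 1) ∘ₗ (TensorProduct.mk K A A).flip 1

/-- `Π^R(x) = Σ 1₍₁₎ ε(x 1₍₂₎)`. -/
def piR (Δ : A →ₗ[K] A ⊗[K] A) (ε : A →ₗ[K] K) : A →ₗ[K] A :=
  (TensorProduct.rid K A).toLinearMap ∘ₗ ε.lTensor A ∘ₗ
    LinearMap.mulRight K (Δ 1) ∘ₗ TensorProduct.mk K A A 1

/-- A weak bialgebra structure on the `K`-algebra `A`, with comultiplication `Δ`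
and counit `ε`. -/
structure WeakBialgebra (Δ : A →ₗ[K] A ⊗[K] A) (ε : A →ₗ[K] K) : Prop where
  coassoc : ∀ x : A,
    (TensorProduct.assoc K A A A) (Δ.rTensor A (Δ x)) = Δ.lTensor A (Δ x)
  counit_left : ∀ x : A, (TensorProduct.lid K A) (ε.rTensor A (Δ x)) = x
  counit_right : ∀ x : A, (TensorProduct.rid K A) (ε.lTensor A (Δ x)) = x
  comul_mul : ∀ x y : A, Δ (x * y) = Δ x * Δ y
  weak_counit_a : ∀ x y z : A,
    ε (x * y * z) =
      LinearMap.mul' K K (TensorProduct.map (ε ∘ₗ LinearMap.mulLeft K x)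
        (ε ∘ₗ LinearMap.mulRight K z) (Δ y))
  weak_counit_b : ∀ x y z : A,
    ε (x * y * z) =
      LinearMap.mul' K K (TensorProduct.map (ε ∘ₗ LinearMap.mulRight K z)
        (ε ∘ₗ LinearMap.mulLeft K x) (Δ y))
  weak_comul_unit_a :
    Δ.rTensor A (Δ 1) =
      (Δ 1 ⊗ₜ[K] (1 : A)) * ((TensorProduct.assoc K A A A).symm ((1 : A) ⊗ₜ[K] Δ 1))
  weak_comul_unit_b :
    Δ.rTensor A (Δ 1) =
      ((TensorProduct.assoc K A A A).symm ((1 : A) ⊗ₜ[K] Δ 1)) * (Δ 1 ⊗ₜ[K] (1 : A))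

/-- A weak Hopf algebra structure: a weak bialgebra together with an antipode `S`. -/
structure WeakHopfAlgebra (Δ : A →ₗ[K] A ⊗[K] A) (ε : A →ₗ[K] K) (S : A →ₗ[K] A) : Prop where
  toWeakBialgebra : WeakBialgebra K A Δ ε
  antipode_a : ∀ x : A,
    LinearMap.mul' K A (LinearMap.lTensor A S (Δ x)) = piL K A Δ ε x
  antipode_b : ∀ x : A,
    LinearMap.mul' K A (LinearMap.rTensor A S (Δ x)) = piR K A Δ ε x
  antipode_c : ∀ x : A,
    LinearMap.mul' K A (TensorProduct.map S (LinearMap.mul' K A ∘ₗ LinearMap.lTensor A S)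
      (LinearMap.lTensor A Δ (Δ x))) = S x

section

variable {K A}

namespace WeakBialgebra

variable {Δ : A →ₗ[K] A ⊗[K] A} {ε : A →ₗ[K] K}

theorem assoc_unit_mul_left (u v : A ⊗[K] A) :
    TensorProduct.assoc K A A A
        ((TensorProduct.assoc K A A A).symm ((1 : A) ⊗ₜ[K] v) * (u ⊗ₜ[K] (1 : A))) =
      (LinearMap.mulLeft K v ∘ₗ (TensorProduct.mk K A A).flip 1).lTensor A u := by
  induction u with
  | zero => simp
  | add a b ha hb => simp only [add_tmul, mul_add, map_add, ha, hb]
  | tmul a b =>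
    induction v with
    | zero => simp
    | add c d hc hd =>
      simp only [tmul_add, add_mul, map_add, hc, hd, LinearMap.lTensor_tmul,
        LinearMap.comp_apply, LinearMap.mulLeft_apply]
    | tmul c d => simp

theorem assoc_unit_mul_right (u v : A ⊗[K] A) :
    TensorProduct.assoc K A A A
        ((u ⊗ₜ[K] (1 : A)) * (TensorProduct.assoc K A A A).symm ((1 : A) ⊗ₜ[K] v)) =
      (LinearMap.mulRight K v ∘ₗ (TensorProduct.mk K A A).flip 1).lTensor A u := by
  induction u with
  | zero => simp
  | add a b ha hb => simp only [add_tmul, add_mul, map_add, ha, hb]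
  | tmul a b =>
    induction v with
    | zero => simp
    | add c d hc hd =>
      simp only [tmul_add, mul_add, map_add, hc, hd, LinearMap.lTensor_tmul,
        LinearMap.comp_apply, LinearMap.mulRight_apply]
    | tmul c d => simp

theorem unit_mul_left (u v : A ⊗[K] A) :
    (TensorProduct.assoc K A A A).symm ((1 : A) ⊗ₜ[K] v) * (u ⊗ₜ[K] (1 : A)) =
      (LinearMap.mulRight K u ∘ₗ TensorProduct.mk K A A 1).rTensor A v := by
  induction v with
  | zero => simp
  | add a b ha hb => simp only [tmul_add, add_mul, map_add, ha, hb]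
  | tmul a b =>
    induction u with
    | zero => simp
    | add c d hc hd =>
      simp only [add_tmul, mul_add, hc, hd, LinearMap.rTensor_tmul,
        LinearMap.comp_apply, LinearMap.mulRight_apply]
    | tmul c d => simp

theorem unit_mul_right (u v : A ⊗[K] A) :
    (u ⊗ₜ[K] (1 : A)) * (TensorProduct.assoc K A A A).symm ((1 : A) ⊗ₜ[K] v) =
      (LinearMap.mulLeft K u ∘ₗ TensorProduct.mk K A A 1).rTensor A v := by
  induction v with
  | zero => simp
  | add a b ha hb => simp only [tmul_add, mul_add, map_add, ha, hb]
  | tmul a b =>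
    induction u with
    | zero => simp
    | add c d hc hd =>
      simp only [add_tmul, add_mul, hc, hd, LinearMap.rTensor_tmul,
        LinearMap.comp_apply, LinearMap.mulLeft_apply]
    | tmul c d => simp

theorem one_mul_comul (h : WeakBialgebra K A Δ ε) (x : A) : Δ 1 * Δ x = Δ x := by
  rw [← h.comul_mul, one_mul]

theorem comul_mul_one (h : WeakBialgebra K A Δ ε) (x : A) : Δ x * Δ 1 = Δ x := by
  rw [← h.comul_mul, mul_one]

/-- `Σ 1₍₁₎ ⊗ 1₍₂₎ ⊗ 1₍₃₎ = Σ 1₍₁₎ ⊗ u₍₁₎ 1₍₂₎ ⊗ u₍₂₎`, where `u = 1`. -/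
theorem lTensor_comul_one_left (h : WeakBialgebra K A Δ ε) :
    Δ.lTensor A (Δ 1) =
      (LinearMap.mulLeft K (Δ 1) ∘ₗ (TensorProduct.mk K A A).flip 1).lTensor A (Δ 1) := by
  rw [← h.coassoc, h.weak_comul_unit_b, assoc_unit_mul_left]

/-- `Σ 1₍₁₎ ⊗ 1₍₂₎ ⊗ 1₍₃₎ = Σ 1₍₁₎ ⊗ 1₍₂₎ u₍₁₎ ⊗ u₍₂₎`, where `u = 1`. -/
theorem lTensor_comul_one_right (h : WeakBialgebra K A Δ ε) :
    Δ.lTensor A (Δ 1) =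
      (LinearMap.mulRight K (Δ 1) ∘ₗ (TensorProduct.mk K A A).flip 1).lTensor A (Δ 1) := by
  rw [← h.coassoc, h.weak_comul_unit_a, assoc_unit_mul_right]

/-- `ε(x Π^L(y)) = ε(x y)`. -/
theorem counit_mul_piL (h : WeakBialgebra K A Δ ε) (x y : A) :
    ε (x * piL K A Δ ε y) = ε (x * y) := by
  have := h.weak_counit_b x 1 y
  rw [mul_one] at this
  rw [this]
  simp only [piL, LinearMap.comp_apply, LinearMap.mulLeft_apply, LinearMap.flip_apply,
    TensorProduct.mk_apply]
  induction Δ 1 with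
  | zero => simp
  | add a b ha hb => simp only [add_mul, mul_add, map_add, ha, hb]
  | tmul a b => simp

/-- `ε(Π^R(x) y) = ε(x y)`. -/
theorem counit_piR_mul (h : WeakBialgebra K A Δ ε) (x y : A) :
    ε (piR K A Δ ε x * y) = ε (x * y) := by
  have := h.weak_counit_b x 1 y
  rw [mul_one] at this
  rw [this]
  simp only [piR, LinearMap.comp_apply, LinearMap.mulRight_apply, TensorProduct.mk_apply]
  induction Δ 1 with
  | zero => simp
  | add a b ha hb => simp only [add_mul, mul_add, map_add, ha, hb]
  | tmul a b => simp [mul_comm]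

/-- `Σ Π^R(x₍₁₎) ⊗ x₍₂₎ = Σ 1₍₁₎ ⊗ x 1₍₂₎`. -/
theorem rTensor_piR_comul (h : WeakBialgebra K A Δ ε) (x : A) :
    (piR K A Δ ε).rTensor A (Δ x) = (1 ⊗ₜ[K] x) * Δ 1 := by
  let G : A ⊗[K] A →ₗ[K] A :=
    (TensorProduct.lid K A).toLinearMap ∘ₗ ε.rTensor A ∘ₗ LinearMap.mulLeft K (Δ x)
  have e := congrArg (G.lTensor A) h.lTensor_comul_one_left
  rw [← LinearMap.lTensor_comp_apply, ← LinearMap.lTensor_comp_apply] at e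
  have e1 : G ∘ₗ Δ = LinearMap.mulLeft K x := by
    ext b
    simp [G, ← h.comul_mul, h.counit_left]
  have e2 : G ∘ₗ LinearMap.mulLeft K (Δ 1) = G := by
    ext b
    simp [G, ← mul_assoc, h.comul_mul_one]
  rw [← LinearMap.comp_assoc, e1, e2] at e
  trans (LinearMap.mulLeft K x).lTensor A (Δ 1)
  · rw [e]
    have key : ∀ t u : A ⊗[K] A,
        ((TensorProduct.rid K A).toLinearMap ∘ₗ ε.lTensor A ∘ₗ
          LinearMap.mulRight K u ∘ₗ TensorProduct.mk K A A 1).rTensor A t =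
        (((TensorProduct.lid K A).toLinearMap ∘ₗ ε.rTensor A ∘ₗ LinearMap.mulLeft K t) ∘ₗ
          (TensorProduct.mk K A A).flip 1).lTensor A u := by
      intro t u
      induction u with
      | zero =>
        induction t with
        | zero => simp
        | add a b ha hb => simp
        | tmul a b => simp
      | add a b ha hb =>
        rw [map_add, ← ha, ← hb]
        clear ha hb
        induction t with
        | zero => simp
        | add c d hc hd => rw [map_add, map_add, map_add, hc, hd]; abel
        | tmul c d => simp [mul_add, add_tmul]
      | tmul a b =>
        induction t with
        | zero => simp
        | add c d hc hd =>
          rw [map_add, hc, hd]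
          simp [add_mul, tmul_add]
        | tmul c d => simp [smul_tmul]
    exact key (Δ x) (Δ 1)
  · induction Δ 1 with
    | zero => simp
    | add a b ha hb => simp only [mul_add, map_add, ha, hb]
    | tmul a b => simp

/-- `Σ x₍₁₎ ⊗ Π^L(x₍₂₎) = Σ 1₍₁₎ x ⊗ 1₍₂₎`. -/
theorem lTensor_piL_comul (h : WeakBialgebra K A Δ ε) (x : A) :
    (piL K A Δ ε).lTensor A (Δ x) = Δ 1 * (x ⊗ₜ[K] 1) := by
  let G : A ⊗[K] A →ₗ[K] A :=
    (TensorProduct.rid K A).toLinearMap ∘ₗ ε.lTensor A ∘ₗ LinearMap.mulRight K (Δ x)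
  have e := congrArg (G.rTensor A) (h.weak_comul_unit_b.trans (unit_mul_left _ _))
  rw [← LinearMap.rTensor_comp_apply, ← LinearMap.rTensor_comp_apply] at e
  have e1 : G ∘ₗ Δ = LinearMap.mulRight K x := by
    ext b
    simp [G, ← h.comul_mul, h.counit_right]
  have e2 : G ∘ₗ LinearMap.mulRight K (Δ 1) = G := by
    ext b
    simp [G, mul_assoc, h.one_mul_comul]
  rw [← LinearMap.comp_assoc, e1, e2] at e
  trans (LinearMap.mulRight K x).rTensor A (Δ 1)
  · rw [e]
    have key : ∀ t u : A ⊗[K] A,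
        ((TensorProduct.lid K A).toLinearMap ∘ₗ ε.rTensor A ∘ₗ
          LinearMap.mulLeft K u ∘ₗ (TensorProduct.mk K A A).flip 1).lTensor A t =
        (((TensorProduct.rid K A).toLinearMap ∘ₗ ε.lTensor A ∘ₗ LinearMap.mulRight K t) ∘ₗ
          TensorProduct.mk K A A 1).rTensor A u := by
      intro t u
      induction u with
      | zero =>
        induction t with
        | zero => simp
        | add a b ha hb => simp
        | tmul a b => simp
      | add a b ha hb =>
        rw [map_add, ← ha, ← hb]
        clear ha hb
        induction t with
        | zero => simp
        | add c d hc hd => rw [map_add, map_add, map_add, hc, hd]; abel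
        | tmul c d => simp [add_mul, tmul_add]
      | tmul a b =>
        induction t with
        | zero => simp
        | add c d hc hd =>
          rw [map_add, hc, hd]
          simp [mul_add, add_tmul]
        | tmul c d => simp [smul_tmul]
    exact key (Δ x) (Δ 1)
  · induction Δ 1 with
    | zero => simp
    | add a b ha hb => simp only [add_mul, map_add, ha, hb]
    | tmul a b => simp

/-- `Δ(Π^L(y)) = (Π^L(y) ⊗ 1) Δ(1)`. -/
theorem comul_piL (h : WeakBialgebra K A Δ ε) (y : A) :
    Δ (piL K A Δ ε y) = (piL K A Δ ε y ⊗ₜ[K] 1) * Δ 1 := by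
  have e := congrArg ((TensorProduct.lid K (A ⊗[K] A)).toLinearMap ∘ₗ
    (ε ∘ₗ LinearMap.mulRight K y).rTensor (A ⊗[K] A)) h.lTensor_comul_one_right
  have key : ∀ (u : A ⊗[K] A) (F : A →ₗ[K] A ⊗[K] A),
      ((TensorProduct.lid K (A ⊗[K] A)).toLinearMap ∘ₗ
        (ε ∘ₗ LinearMap.mulRight K y).rTensor (A ⊗[K] A)) (F.lTensor A u) =
      F (TensorProduct.lid K A (ε.rTensor A (u * (y ⊗ₜ[K] 1)))) := by
    intro u F
    induction u with
    | zero => simp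
    | add a b ha hb => simp only [add_mul, map_add, ha, hb]
    | tmul a b => simp
  rw [key, key] at e
  simpa [piL] using e

/-- `Δ(Π^R(y)) = Δ(1) (1 ⊗ Π^R(y))`. -/
theorem comul_piR (h : WeakBialgebra K A Δ ε) (y : A) :
    Δ (piR K A Δ ε y) = Δ 1 * (1 ⊗ₜ[K] piR K A Δ ε y) := by
  have e := congrArg ((TensorProduct.rid K (A ⊗[K] A)).toLinearMap ∘ₗ
    (ε ∘ₗ LinearMap.mulLeft K y).lTensor (A ⊗[K] A))
    (h.weak_comul_unit_a.trans (unit_mul_right _ _))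
  have key : ∀ (u : A ⊗[K] A) (F : A →ₗ[K] A ⊗[K] A),
      ((TensorProduct.rid K (A ⊗[K] A)).toLinearMap ∘ₗ
        (ε ∘ₗ LinearMap.mulLeft K y).lTensor (A ⊗[K] A)) (F.rTensor A u) =
      F (TensorProduct.rid K A (ε.lTensor A ((1 ⊗ₜ[K] y) * u))) := by
    intro u F
    induction u with
    | zero => simp
    | add a b ha hb => simp only [mul_add, map_add, ha, hb]
    | tmul a b => simp
  rw [key, key] at e
  simpa [piR] using e

/-- `Σ ε(x y₍₁₎) y₍₂₎ = Σ ε(x 1₍₁₎) 1₍₂₎ y`. -/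
theorem counit_mul_comul (h : WeakBialgebra K A Δ ε) (x y : A) :
    TensorProduct.lid K A ((ε ∘ₗ LinearMap.mulLeft K x).rTensor A (Δ y)) =
      TensorProduct.lid K A ((ε ∘ₗ LinearMap.mulLeft K x).rTensor A (Δ 1)) * y := by
  let G : A ⊗[K] A →ₗ[K] A :=
    (TensorProduct.lid K A).toLinearMap ∘ₗ ε.rTensor A ∘ₗ LinearMap.mulRight K (Δ y)
  have e := congrArg ((TensorProduct.lid K A).toLinearMap ∘ₗ
    (ε ∘ₗ LinearMap.mulLeft K x).rTensor A ∘ₗ G.lTensor A) h.lTensor_comul_one_right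
  simp only [LinearMap.comp_apply] at e
  rw [← LinearMap.lTensor_comp_apply, ← LinearMap.lTensor_comp_apply] at e
  have e1 : G ∘ₗ Δ = LinearMap.mulRight K y := by
    ext b
    simp [G, ← h.comul_mul, h.counit_left]
  have e2 : G ∘ₗ LinearMap.mulRight K (Δ 1) = G := by
    ext b
    simp [G, mul_assoc, h.one_mul_comul]
  rw [← LinearMap.comp_assoc, e1, e2] at e
  trans TensorProduct.lid K A ((ε ∘ₗ LinearMap.mulLeft K x).rTensor A
    ((LinearMap.mulRight K y).lTensor A (Δ 1)))
  · refine Eq.trans ?_ e.symm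
    have e3 : ε ∘ₗ LinearMap.mulLeft K x = LinearMap.mul' K K ∘ₗ
        TensorProduct.map (ε ∘ₗ LinearMap.mulLeft K x) ε ∘ₗ LinearMap.mulLeft K (Δ 1) ∘ₗ
          TensorProduct.mk K A A 1 := by
      ext z
      have := h.weak_counit_a x 1 z
      rw [mul_one] at this
      simp only [LinearMap.comp_apply, LinearMap.mulLeft_apply, TensorProduct.mk_apply, this]
      induction Δ 1 with
      | zero => simp
      | add a b ha hb => simp only [add_mul, map_add, ha, hb]
      | tmul a b => simp
    have key : ∀ t u : A ⊗[K] A,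
        TensorProduct.lid K A ((LinearMap.mul' K K ∘ₗ
          TensorProduct.map (ε ∘ₗ LinearMap.mulLeft K x) ε ∘ₗ LinearMap.mulLeft K u ∘ₗ
            TensorProduct.mk K A A 1).rTensor A t) =
        TensorProduct.lid K A ((ε ∘ₗ LinearMap.mulLeft K x).rTensor A
          ((((TensorProduct.lid K A).toLinearMap ∘ₗ ε.rTensor A ∘ₗ LinearMap.mulRight K t) ∘ₗ
            (TensorProduct.mk K A A).flip 1).lTensor A u)) := by
      intro t u
      induction t with
      | zero =>
        induction u with
        | zero => simp
        | add a b ha hb => simp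
        | tmul a b => simp
      | add a b ha hb =>
        rw [map_add, map_add, ha, hb]
        clear ha hb
        induction u with
        | zero => simp
        | add c d hc hd => simp only [map_add, ← hc, ← hd]; abel
        | tmul c d => simp [mul_add, smul_add]
      | tmul a b =>
        induction u with
        | zero => simp
        | add c d hc hd =>
          simp only [map_add, ← hc, ← hd]
          simp [add_mul, add_smul]
        | tmul c d => simp [smul_smul, mul_comm]
    exact (congrArg (fun f : A →ₗ[K] K => TensorProduct.lid K A (f.rTensor A (Δ y))) e3).trans
      (key (Δ y) (Δ 1))
  · induction Δ 1 with
    | zero => simp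
    | add a b ha hb => simp only [add_mul, map_add, ha, hb]
    | tmul a b => simp

end WeakBialgebra

namespace WeakHopfAlgebra

variable {Δ : A →ₗ[K] A ⊗[K] A} {ε : A →ₗ[K] K} {S : A →ₗ[K] A}

/-- `Σ S(x₍₁₎) Π^L(x₍₂₎) = S(x)`. -/
theorem antipode_mul_piL (h : WeakHopfAlgebra K A Δ ε S) (x : A) :
    LinearMap.mul' K A (TensorProduct.map S (piL K A Δ ε) (Δ x)) = S x := by
  have e : piL K A Δ ε = (LinearMap.mul' K A ∘ₗ S.lTensor A) ∘ₗ Δ := by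
    ext y
    exact (h.antipode_a y).symm
  rw [← h.antipode_c x, e]
  induction Δ x with
  | zero => simp
  | add a b ha hb => simp only [map_add, ha, hb]
  | tmul a b => simp

/-- `Σ Π^R(x₍₁₎) S(x₍₂₎) = S(x)`. -/
theorem piR_mul_antipode (h : WeakHopfAlgebra K A Δ ε S) (x : A) :
    LinearMap.mul' K A (TensorProduct.map (piR K A Δ ε) S (Δ x)) = S x := by
  have e : piR K A Δ ε = (LinearMap.mul' K A ∘ₗ S.rTensor A) ∘ₗ Δ := by
    ext y
    exact (h.antipode_b y).symm
  rw [← h.antipode_c x, ← h.toWeakBialgebra.coassoc, e]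
  induction Δ x with
  | zero => simp
  | add a b ha hb => simp only [map_add, ha, hb]
  | tmul a b =>
    simp only [map_tmul, LinearMap.rTensor_tmul, LinearMap.comp_apply]
    induction Δ a with
    | zero => simp
    | add c d hc hd => simp only [add_tmul, map_add, hc, hd]
    | tmul c d => simp [mul_assoc]

/-- A left integral `l` satisfies `Σ S(x) l₍₁₎ ⊗ l₍₂₎ = Σ l₍₁₎ ⊗ x l₍₂₎`. -/
theorem antipode_mul_comul_integral (h : WeakHopfAlgebra K A Δ ε S) {l : A}
    (hl : ∀ x : A, x * l = piL K A Δ ε x * l) (x : A) :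
    (S x ⊗ₜ[K] 1) * Δ l = (1 ⊗ₜ[K] x) * Δ l := by
  have hΔ (y : A) : (piL K A Δ ε y ⊗ₜ[K] 1) * Δ l = Δ y * Δ l := by
    rw [← h.toWeakBialgebra.comul_mul, hl, h.toWeakBialgebra.comul_mul,
      h.toWeakBialgebra.comul_piL, mul_assoc, h.toWeakBialgebra.one_mul_comul]
  let M : A ⊗[K] (A ⊗[K] A) →ₗ[K] A ⊗[K] A :=
    (LinearMap.mul' K A ∘ₗ S.rTensor A).rTensor A ∘ₗ (TensorProduct.assoc K A A A).symm.toLinearMap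
  have e : M (Δ.lTensor A (Δ x)) = (1 ⊗ₜ[K] x) * Δ 1 := by
    rw [← h.toWeakBialgebra.rTensor_piR_comul, ← h.toWeakBialgebra.coassoc]
    simp only [M, LinearMap.comp_apply, LinearEquiv.coe_coe, LinearEquiv.symm_apply_apply]
    rw [← LinearMap.rTensor_comp_apply]
    congr 2
    ext y
    exact h.antipode_b y
  rw [← h.toWeakBialgebra.one_mul_comul l, ← mul_assoc, ← mul_assoc, ← e, mul_assoc,
    h.toWeakBialgebra.one_mul_comul, ← h.antipode_mul_piL x]
  induction Δ x with
  | zero => simp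
  | add a b ha hb => simp only [map_add, add_tmul, add_mul, ha, hb]
  | tmul a b =>
    have e2 : M (Δ.lTensor A (a ⊗ₜ[K] b)) = (S a ⊗ₜ[K] 1) * Δ b := by
      simp only [M, LinearMap.comp_apply, LinearEquiv.coe_coe, LinearMap.lTensor_tmul]
      induction Δ b with
      | zero => simp
      | add c d hc hd => simp only [tmul_add, map_add, mul_add, hc, hd]
      | tmul c d => simp
    rw [e2, mul_assoc, ← hΔ, ← mul_assoc]
    simp

/-- A right integral `r` satisfies `Σ r₍₁₎ ⊗ r₍₂₎ S(x) = Σ r₍₁₎ x ⊗ r₍₂₎`. -/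
theorem comul_integral_mul_antipode (h : WeakHopfAlgebra K A Δ ε S) {r : A}
    (hr : ∀ x : A, r * x = r * piR K A Δ ε x) (x : A) :
    Δ r * (1 ⊗ₜ[K] S x) = Δ r * (x ⊗ₜ[K] 1) := by
  have hΔ (y : A) : Δ r * (1 ⊗ₜ[K] piR K A Δ ε y) = Δ r * Δ y := by
    rw [← h.toWeakBialgebra.comul_mul, hr, h.toWeakBialgebra.comul_mul,
      h.toWeakBialgebra.comul_piR, ← mul_assoc, h.toWeakBialgebra.comul_mul_one]
  let M : (A ⊗[K] A) ⊗[K] A →ₗ[K] A ⊗[K] A :=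
    (LinearMap.mul' K A ∘ₗ S.lTensor A).lTensor A ∘ₗ (TensorProduct.assoc K A A A).toLinearMap
  have e : M (Δ.rTensor A (Δ x)) = Δ 1 * (x ⊗ₜ[K] 1) := by
    rw [← h.toWeakBialgebra.lTensor_piL_comul]
    simp only [M, LinearMap.comp_apply, LinearEquiv.coe_coe]
    rw [h.toWeakBialgebra.coassoc, ← LinearMap.lTensor_comp_apply]
    congr 2
    ext y
    exact h.antipode_a y
  rw [← h.toWeakBialgebra.comul_mul_one r, mul_assoc _ _ (x ⊗ₜ[K] 1), ← e,
    h.toWeakBialgebra.comul_mul_one, ← h.piR_mul_antipode x]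
  induction Δ x with
  | zero => simp
  | add a b ha hb => simp only [map_add, tmul_add, mul_add, ha, hb]
  | tmul a b =>
    have e2 : M (Δ.rTensor A (a ⊗ₜ[K] b)) = Δ a * (1 ⊗ₜ[K] S b) := by
      simp only [M, LinearMap.comp_apply, LinearEquiv.coe_coe, LinearMap.rTensor_tmul]
      induction Δ a with
      | zero => simp
      | add c d hc hd => simp only [add_tmul, map_add, add_mul, hc, hd]
      | tmul c d => simp
    rw [e2, ← mul_assoc, ← hΔ, mul_assoc]
    simp

/-- `Σ i₍₁₎ φ(x i₍₂₎) = S(x) Σ i₍₁₎ φ(i₍₂₎)` for a left integral `i`. -/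
theorem contract_comp_mulLeft (h : WeakHopfAlgebra K A Δ ε S) {i : A}
    (hi : ∀ x : A, x * i = piL K A Δ ε x * i) (φ : A →ₗ[K] K) (x : A) :
    TensorProduct.rid K A ((φ ∘ₗ LinearMap.mulLeft K x).lTensor A (Δ i)) =
      S x * TensorProduct.rid K A (φ.lTensor A (Δ i)) := by
  have e := congrArg (fun t => TensorProduct.rid K A (φ.lTensor A t))
    (h.antipode_mul_comul_integral hi x)
  convert e.symm using 1
  all_goals
    induction Δ i with
    | zero => simp
    | add a b ha hb => simp only [mul_add, map_add, ha, hb]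
    | tmul a b => simp

/-- `Σ i₍₁₎ φ(i₍₂₎ S(x)) = Σ i₍₁₎ φ(i₍₂₎) x` for a right integral `i`. -/
theorem contract_comp_mulRight (h : WeakHopfAlgebra K A Δ ε S) {i : A}
    (hi : ∀ x : A, i * x = i * piR K A Δ ε x) (φ : A →ₗ[K] K) (x : A) :
    TensorProduct.rid K A ((φ ∘ₗ LinearMap.mulRight K (S x)).lTensor A (Δ i)) =
      TensorProduct.rid K A (φ.lTensor A (Δ i)) * x := by
  have e := congrArg (fun t => TensorProduct.rid K A (φ.lTensor A t))
    (h.comul_integral_mul_antipode hi x)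
  convert e using 1
  all_goals
    induction Δ i with
    | zero => simp
    | add a b ha hb => simp only [add_mul, map_add, ha, hb]
    | tmul a b => simp

/-- A nondegenerate two-sided integral has a dual functional, which is nondegenerate and has
Nakayama automorphism `S²`. -/
theorem exists_dual_functional (h : WeakHopfAlgebra K A Δ ε S) {i : A}
    (hl : ∀ x : A, x * i = piL K A Δ ε x * i) (hr : ∀ x : A, i * x = i * piR K A Δ ε x)
    (hb : Function.Bijective
      (fun φ : A →ₗ[K] K => (TensorProduct.rid K A) (LinearMap.lTensor A φ (Δ i)))) :
    ∃ φ : A →ₗ[K] K, (∀ x y : A, φ (y * S (S x)) = φ (x * y)) ∧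
      ∀ x : A, (∀ y : A, φ (x * y) = 0) → x = 0 := by
  obtain ⟨φ, hφ⟩ := hb.2 1
  have hφ' : TensorProduct.rid K A (φ.lTensor A (Δ i)) = 1 := hφ
  have hL (x : A) := h.contract_comp_mulLeft hl φ x
  have hR (x : A) := h.contract_comp_mulRight hr φ x
  simp only [hφ', mul_one, one_mul] at hL hR
  refine ⟨φ, fun x y => ?_, fun x hx => ?_⟩
  · have e : φ ∘ₗ LinearMap.mulRight K (S (S x)) = φ ∘ₗ LinearMap.mulLeft K x :=
      hb.1 ((hR (S x)).trans (hL x).symm)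
    simpa using LinearMap.congr_fun e y
  · have e : φ ∘ₗ LinearMap.mulLeft K x = 0 := by
      ext y
      simpa using hx y
    have hS : S x = 0 := by simpa [e] using (hL x).symm
    simpa [hS] using (hR x).symm

/-- For a right integral `i`, the elements `Σ i₍₁₎ F(i₍₂₎)` are of the form
`Σ i₍₁₎ φ(i₍₂₎)`. -/
theorem exists_contract_eq [FiniteDimensional K A] (h : WeakHopfAlgebra K A Δ ε S) {i : A}
    (hi : ∀ x : A, i * x = i * piR K A Δ ε x) (F : A →ₗ[K] A) :
    ∃ φ : A →ₗ[K] K, TensorProduct.rid K A (φ.lTensor A (Δ i)) =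
      LinearMap.mul' K A (F.lTensor A (Δ i)) := by
  let b := Module.finBasis K A
  refine ⟨∑ k, (b.coord k ∘ₗ F) ∘ₗ LinearMap.mulRight K (S (b k)), ?_⟩
  have e : ∀ φ : A →ₗ[K] K, TensorProduct.rid K A (φ.lTensor A (Δ i)) =
      ((TensorProduct.rid K A).toLinearMap ∘ₗ LinearMap.applyₗ (Δ i) ∘ₗ
        LinearMap.lTensorHom A) φ := fun _ => rfl
  rw [e, map_sum]
  simp only [← e, h.contract_comp_mulRight hi]
  induction Δ i with
  | zero => simp
  | add c d hc hd => simp only [map_add, add_mul, Finset.sum_add_distrib, hc, hd]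
  | tmul c d =>
    have e2 : c * F d = ∑ k, b.repr (F d) k • (c * b k) := by
      simp_rw [← mul_smul_comm, ← Finset.mul_sum, b.sum_repr]
    simp [e2]

/-- If `i` is the element representing the counit with respect to a symmetric form `τ`, then
`Σ Π^L(i₍₁₎) τ(i₍₂₎) = 1`. -/
theorem piL_contract_eq_one (h : WeakBialgebra K A Δ ε) {τ : A →ₗ[K] K} {i : A}
    (hi : ∀ x : A, τ (x * i) = ε x) :
    piL K A Δ ε (TensorProduct.rid K A (τ.lTensor A (Δ i))) = 1 := by
  have hx (x : A) : ε (x * TensorProduct.rid K A (τ.lTensor A (Δ i))) = ε x := by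
    have e := congrArg τ (h.counit_mul_comul x i)
    rw [hi] at e
    trans τ (TensorProduct.lid K A ((ε ∘ₗ LinearMap.mulLeft K x).rTensor A (Δ i)))
    · induction Δ i with
      | zero => simp
      | add c d hc hd => simp only [map_add, mul_add, hc, hd]
      | tmul c d => simp [mul_comm]
    · rw [e]
      trans ε (x * TensorProduct.rid K A (ε.lTensor A (Δ 1)))
      · induction Δ 1 with
        | zero => simp
        | add c d hc hd => simp only [map_add, mul_add, hc, hd]
        | tmul c d => simp [mul_comm]
      · rw [h.counit_right, mul_one]
  refine Eq.trans ?_ (h.counit_left 1)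
  simp only [piL, LinearMap.comp_apply, LinearMap.mulLeft_apply, LinearMap.flip_apply,
    TensorProduct.mk_apply, LinearEquiv.coe_coe]
  induction Δ 1 with
  | zero => simp
  | add c d hc hd => simp only [map_add, add_mul, hc, hd]
  | tmul c d => simp [hx]

/-- The element representing the counit with respect to a symmetric form is nondegenerate. -/
theorem contract_bijective [FiniteDimensional K A] (h : WeakHopfAlgebra K A Δ ε S)
    {τ : A →ₗ[K] K} {i : A} (hi : ∀ x : A, τ (x * i) = ε x)
    (hr : ∀ x : A, i * x = i * piR K A Δ ε x) :
    Function.Bijective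
      (fun φ : A →ₗ[K] K => (TensorProduct.rid K A) (LinearMap.lTensor A φ (Δ i))) := by
  let Θ : (A →ₗ[K] K) →ₗ[K] A := (TensorProduct.rid K A).toLinearMap ∘ₗ
    LinearMap.applyₗ (Δ i) ∘ₗ LinearMap.lTensorHom A
  let R : A →ₗ[K] A := (TensorProduct.rid K A).toLinearMap ∘ₗ TensorProduct.map S τ ∘ₗ Δ
  obtain ⟨φ, hφ⟩ := h.exists_contract_eq hr R
  have hR : LinearMap.mul' K A (R.lTensor A (Δ i)) = 1 := by
    rw [← piL_contract_eq_one h.toWeakBialgebra hi, ← h.antipode_a]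
    trans LinearMap.mul' K A (S.lTensor A (TensorProduct.rid K (A ⊗[K] A)
      (τ.lTensor (A ⊗[K] A)
        ((TensorProduct.assoc K A A A).symm (Δ.lTensor A (Δ i))))))
    · induction Δ i with
      | zero => simp
      | add c d hc hd => simp only [map_add, hc, hd]
      | tmul c d =>
        simp only [R, LinearMap.lTensor_tmul, LinearMap.comp_apply, LinearEquiv.coe_coe]
        induction Δ d with
        | zero => simp
        | add a b ha hb => simp only [map_add, tmul_add, ha, hb]
        | tmul a b => simp
    · rw [← h.toWeakBialgebra.coassoc, LinearEquiv.symm_apply_apply]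
      congr 2
      induction Δ i with
      | zero => simp
      | add c d hc hd => simp only [map_add, hc, hd]
      | tmul c d => simp
  have hsurj : Function.Surjective Θ := fun x =>
    ⟨φ ∘ₗ LinearMap.mulRight K (S x),
      (h.contract_comp_mulRight hr φ x).trans (by rw [hφ, hR, one_mul])⟩
  exact ⟨(LinearMap.injective_iff_surjective_of_finrank_eq_finrank
    Subspace.dual_finrank_eq).2 hsurj, hsurj⟩

end WeakHopfAlgebra

/-- A nondegenerate functional represents every functional. -/
theorem exists_eq_functional_mul_left [FiniteDimensional K A] {τ : A →ₗ[K] K}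
    (hτ : ∀ x : A, (∀ y : A, τ (x * y) = 0) → x = 0) (φ : A →ₗ[K] K) :
    ∃ u : A, ∀ x : A, τ (u * x) = φ x := by
  let T : A →ₗ[K] Module.Dual K A := LinearMap.compr₂ (LinearMap.mul K A) τ
  have hinj : Function.Injective T := by
    rw [injective_iff_map_eq_zero]
    exact fun x hx => hτ x fun y => LinearMap.congr_fun hx y
  obtain ⟨u, hu⟩ := (LinearMap.injective_iff_surjective_of_finrank_eq_finrank
    Subspace.dual_finrank_eq.symm).1 hinj φ
  exact ⟨u, fun x => LinearMap.congr_fun hu x⟩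

end

/-- A weak Hopf algebra `A` over a field `K` is a symmetric algebra
if and only if `A` contains a nondegenerate two-sided integral and `S²` is an inner
automorphism. -/
theorem weakHopfAlgebra_symmetric_iff
    (K : Type*) [Field K] (A : Type*) [Ring A] [Algebra K A] [FiniteDimensional K A]
    (Δ : A →ₗ[K] A ⊗[K] A) (ε : A →ₗ[K] K) (S : A →ₗ[K] A)
    (hA : WeakHopfAlgebra K A Δ ε S) :
    (∃ τ : A →ₗ[K] K,
        (∀ x y : A, τ (x * y) = τ (y * x)) ∧
        (∀ x : A, (∀ y : A, τ (x * y) = 0) → x = 0) ∧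
        (∀ y : A, (∀ x : A, τ (x * y) = 0) → y = 0)) ↔
    ((∃ i : A, (∀ x : A, x * i = piL K A Δ ε x * i) ∧
        (∀ x : A, i * x = i * piR K A Δ ε x) ∧
        Function.Bijective
          (fun φ : A →ₗ[K] K => (TensorProduct.rid K A) (LinearMap.lTensor A φ (Δ i)))) ∧
      (∃ g : Aˣ, ∀ x : A, S (S x) = (g : A) * x * ((g⁻¹ : Aˣ) : A))) := by
  constructor
  · rintro ⟨τ, hsymm, hτ, -⟩
    obtain ⟨i, hi⟩ := exists_eq_functional_mul_left hτ ε
    have hi' (x : A) : τ (x * i) = ε x := (hsymm x i).trans (hi x)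
    have hl (x : A) : x * i = piL K A Δ ε x * i := by
      rw [← sub_eq_zero]
      refine hτ _ fun y => ?_
      rw [sub_mul, map_sub, hsymm, hsymm (_ * _), ← mul_assoc, ← mul_assoc, hi', hi',
        hA.toWeakBialgebra.counit_mul_piL, sub_self]
    have hr (x : A) : i * x = i * piR K A Δ ε x := by
      rw [← sub_eq_zero]
      refine hτ _ fun y => ?_
      rw [sub_mul, map_sub, mul_assoc, mul_assoc, hi, hi,
        hA.toWeakBialgebra.counit_piR_mul, sub_self]
    have hb := hA.contract_bijective hi' hr
    refine ⟨⟨i, hl, hr, hb⟩, ?_⟩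
    obtain ⟨φ, hφS, hφ⟩ := hA.exists_dual_functional hl hr hb
    obtain ⟨u, hu⟩ := exists_eq_functional_mul_left hτ φ
    have hinj : Function.Injective (LinearMap.mulLeft K u) := by
      rw [injective_iff_map_eq_zero]
      intro x hx
      rw [LinearMap.mulLeft_apply] at hx
      exact hφ x fun y => by rw [← hu, ← mul_assoc, hx, zero_mul, map_zero]
    obtain ⟨v, hv⟩ := LinearMap.injective_iff_surjective.1 hinj 1
    rw [LinearMap.mulLeft_apply] at hv
    have hvu : v * u = 1 := hinj (by simp [← mul_assoc, hv])
    refine ⟨⟨u, v, hv, hvu⟩, fun x => ?_⟩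
    have hux : u * x = S (S x) * u := by
      rw [← sub_eq_zero]
      refine hτ _ fun y => ?_
      rw [sub_mul, map_sub, mul_assoc, hu, ← hφS, ← hu, ← mul_assoc, hsymm, ← mul_assoc,
        sub_self]
    rw [Units.inv_mk]
    simp [hux, mul_assoc, hv]
  · rintro ⟨⟨i, hl, hr, hb⟩, g, hg⟩
    obtain ⟨φ, hφS, hφ⟩ := hA.exists_dual_functional hl hr hb
    let τ : A →ₗ[K] K := φ ∘ₗ LinearMap.mulRight K (g⁻¹ : Aˣ)
    have hsymm (x y : A) : τ (x * y) = τ (y * x) := by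
      have e := hφS x (y * (g⁻¹ : Aˣ))
      rw [hg] at e
      simpa [τ, mul_assoc] using e.symm
    have hτ (x : A) (hx : ∀ y : A, τ (x * y) = 0) : x = 0 :=
      hφ x fun y => by simpa [τ, mul_assoc] using hx (y * g)
    exact ⟨τ, hsymm, hτ, fun y hy => hτ y fun x => (hsymm y x).trans (hy x)⟩
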